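/- arXiv:2209.01215 — 5 statements merged into one kernel-verified Lean document; each statement's English description precedes it below -/
import Mathlib

section
/- A reconstruction s* : Fin N → Bool is RC-feasible if and only if its change-count tuple χ(s*) is RC_E-feasible. -/
open Finset

def G0p {N : ℕ} (sh yh : Fin N → Bool) : Finset (Fin N) :=
  univ.filter (fun i => sh i = false ∧ yh i = true)
def G1p {N : ℕ} (sh yh : Fin N → Bool) : Finset (Fin N) :=
  univ.filter (fun i => sh i = true ∧ yh i = true)
def G0m {N : ℕ} (sh yh : Fin N → Bool) : Finset (Fin N) :=
  univ.filter (fun i => sh i = false ∧ yh i = false)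
def G1m {N : ℕ} (sh yh : Fin N → Bool) : Finset (Fin N) :=
  univ.filter (fun i => sh i = true ∧ yh i = false)

/-- a: changes 0→1 among positively-predicted examples -/
def chgA {N : ℕ} (sh yh s : Fin N → Bool) : ℕ :=
  ((G0p sh yh).filter (fun i => s i = true)).card
/-- b: changes 1→0 among positively-predicted examples -/
def chgB {N : ℕ} (sh yh s : Fin N → Bool) : ℕ :=
  ((G1p sh yh).filter (fun i => s i = false)).card
/-- c: changes 0→1 among negatively-predicted examples -/
def chgC {N : ℕ} (sh yh s : Fin N → Bool) : ℕ :=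
  ((G0m sh yh).filter (fun i => s i = true)).card
/-- d: changes 1→0 among negatively-predicted examples -/
def chgD {N : ℕ} (sh yh s : Fin N → Bool) : ℕ :=
  ((G1m sh yh).filter (fun i => s i = false)).card

/-- RC-feasibility: both protected groups nonempty, and the statistical parity
constraint with tolerance ε holds for each group of the reconstruction s. -/
def RCFeasible {N : ℕ} (yh : Fin N → Bool) (ε : ℝ) (s : Fin N → Bool) : Prop :=
  (univ.filter (fun i => s i = true)).Nonempty ∧
  (univ.filter (fun i => s i = false)).Nonempty ∧
  ∀ g : Bool,
    |((univ.filter (fun i => yh i = true)).card : ℝ) / (N : ℝ) -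
      ((univ.filter (fun i => s i = g ∧ yh i = true)).card : ℝ) /
        ((univ.filter (fun i => s i = g)).card : ℝ)| ≤ ε

/-- RC_E-feasibility of a change-count tuple (a,b,c,d). -/
def RCEFeasible (N k n0p n1p n0m n1m : ℕ) (ε : ℝ) (a b c d : ℕ) : Prop :=
  a ≤ n0p ∧ b ≤ n1p ∧ c ≤ n0m ∧ d ≤ n1m ∧
  a + c < n0p + n0m + b + d ∧
  b + d < n1p + n1m + a + c ∧
  |(k : ℝ) / (N : ℝ) -
    ((n1p : ℝ) - (b : ℝ) + (a : ℝ)) /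
      ((n1p : ℝ) + (n1m : ℝ) - (b : ℝ) - (d : ℝ) + (a : ℝ) + (c : ℝ))| ≤ ε ∧
  |(k : ℝ) / (N : ℝ) -
    ((n0p : ℝ) - (a : ℝ) + (b : ℝ)) /
      ((n0p : ℝ) + (n0m : ℝ) - (a : ℝ) - (c : ℝ) + (b : ℝ) + (d : ℝ))| ≤ ε

theorem card_true_add_changes {N : ℕ} (sh yh s : Fin N → Bool) :
    (univ.filter (fun i => s i = true)).card + chgB sh yh s + chgD sh yh s =
      (G1p sh yh).card + (G1m sh yh).card + chgA sh yh s + chgC sh yh s := by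
  simp only [G0p, G1p, G0m, G1m, chgA, chgB, chgC, chgD, filter_filter, card_filter,
    ← sum_add_distrib]
  refine sum_congr rfl fun i _ => ?_
  cases sh i <;> cases yh i <;> cases s i <;> rfl

theorem card_false_add_changes {N : ℕ} (sh yh s : Fin N → Bool) :
    (univ.filter (fun i => s i = false)).card + chgA sh yh s + chgC sh yh s =
      (G0p sh yh).card + (G0m sh yh).card + chgB sh yh s + chgD sh yh s := by
  simp only [G0p, G1p, G0m, G1m, chgA, chgB, chgC, chgD, filter_filter, card_filter,
    ← sum_add_distrib]
  refine sum_congr rfl fun i _ => ?_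
  cases sh i <;> cases yh i <;> cases s i <;> rfl

theorem card_true_pos_add_changes {N : ℕ} (sh yh s : Fin N → Bool) :
    (univ.filter (fun i => s i = true ∧ yh i = true)).card + chgB sh yh s =
      (G1p sh yh).card + chgA sh yh s := by
  simp only [G0p, G1p, chgA, chgB, filter_filter, card_filter,
    ← sum_add_distrib]
  refine sum_congr rfl fun i _ => ?_
  cases sh i <;> cases yh i <;> cases s i <;> rfl

theorem card_false_pos_add_changes {N : ℕ} (sh yh s : Fin N → Bool) :
    (univ.filter (fun i => s i = false ∧ yh i = true)).card + chgA sh yh s =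
      (G0p sh yh).card + chgB sh yh s := by
  simp only [G0p, G1p, chgA, chgB, filter_filter, card_filter,
    ← sum_add_distrib]
  refine sum_congr rfl fun i _ => ?_
  cases sh i <;> cases yh i <;> cases s i <;> rfl

theorem rc_feasible_iff_rce_feasible (N : ℕ) (hN : 1 ≤ N)
    (sh yh : Fin N → Bool) (ε : ℝ) (hε : 0 ≤ ε) (s : Fin N → Bool) :
    RCFeasible yh ε s ↔
      RCEFeasible N (univ.filter (fun i => yh i = true)).card
        (G0p sh yh).card (G1p sh yh).card (G0m sh yh).card (G1m sh yh).card ε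
        (chgA sh yh s) (chgB sh yh s) (chgC sh yh s) (chgD sh yh s) := by
  have h₁ := card_true_add_changes sh yh s
  have h₀ := card_false_add_changes sh yh s
  have hp₁ := card_true_pos_add_changes sh yh s
  have hp₀ := card_false_pos_add_changes sh yh s
  have ha : chgA sh yh s ≤ (G0p sh yh).card := card_filter_le _ _
  have hb : chgB sh yh s ≤ (G1p sh yh).card := card_filter_le _ _
  have hc : chgC sh yh s ≤ (G0m sh yh).card := card_filter_le _ _
  have hd : chgD sh yh s ≤ (G1m sh yh).card := card_filter_le _ _
  unfold RCFeasible RCEFeasible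
  rw [← card_pos, ← card_pos, Bool.forall_bool]
  generalize (univ.filter (fun i => s i = true)).card = m₁ at *
  generalize (univ.filter (fun i => s i = false)).card = m₀ at *
  generalize (univ.filter (fun i => s i = true ∧ yh i = true)).card = k₁ at *
  generalize (univ.filter (fun i => s i = false ∧ yh i = true)).card = k₀ at *
  generalize chgA sh yh s = a, chgB sh yh s = b, chgC sh yh s = c, chgD sh yh s = d at *
  generalize (G0p sh yh).card = n0p, (G1p sh yh).card = n1p, (G0m sh yh).card = n0m,
    (G1m sh yh).card = n1m at *
  have em₁ : (n1p : ℝ) + n1m - b - d + a + c = m₁ := by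
    have := congrArg (Nat.cast (R := ℝ)) h₁
    push_cast at this; linarith
  have em₀ : (n0p : ℝ) + n0m - a - c + b + d = m₀ := by
    have := congrArg (Nat.cast (R := ℝ)) h₀
    push_cast at this; linarith
  have ek₁ : (n1p : ℝ) - b + a = k₁ := by
    have := congrArg (Nat.cast (R := ℝ)) hp₁
    push_cast at this; linarith
  have ek₀ : (n0p : ℝ) - a + b = k₀ := by
    have := congrArg (Nat.cast (R := ℝ)) hp₀
    push_cast at this; linarith
  rw [em₁, em₀, ek₁, ek₀]
  constructor
  · rintro ⟨hm₁, hm₀, hf₀, hf₁⟩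
    exact ⟨ha, hb, hc, hd, by omega, by omega, hf₁, hf₀⟩
  · rintro ⟨-, -, -, -, hm₀, hm₁, hf₁, hf₀⟩
    exact ⟨by omega, by omega, hf₀, hf₁⟩
end

section
/- If two reconstructions s*, s*' : Fin N → Bool have the same change counts, χ(s*) = χ(s*'), then s* is RC-feasible if and only if s*' is RC-feasible. In other words, RC-feasibility (for statistical parity constraints) depends only on the change-count tuple of the reconstruction. -/
open Finset

/-- Within the examples predicted `v`, the size of the group `s = true` is the size of the
initial group `sh = true`, plus the changes `false → true`, minus the changes `true → false`. -/
lemma card_true_add_card_changes {N : ℕ} (sh yh s : Fin N → Bool) (v : Bool) :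
    #{i | s i = true ∧ yh i = v} + #{i | (sh i = true ∧ yh i = v) ∧ s i = false} =
      #{i | sh i = true ∧ yh i = v} + #{i | (sh i = false ∧ yh i = v) ∧ s i = true} := by
  simp only [card_filter, ← sum_add_distrib]
  refine sum_congr rfl fun i _ => ?_
  cases s i <;> cases sh i <;> simp

lemma card_true_add_card_false {N : ℕ} (yh s : Fin N → Bool) (v : Bool) :
    #{i | s i = true ∧ yh i = v} + #{i | s i = false ∧ yh i = v} = #{i | yh i = v} := by
  simp only [card_filter, ← sum_add_distrib]
  refine sum_congr rfl fun i _ => ?_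
  cases s i <;> simp

lemma card_group_eq_add {N : ℕ} (yh s : Fin N → Bool) (g : Bool) :
    #{i | s i = g} = #{i | s i = g ∧ yh i = true} + #{i | s i = g ∧ yh i = false} := by
  simp only [card_filter, ← sum_add_distrib]
  refine sum_congr rfl fun i _ => ?_
  cases yh i <;> simp

/-- The change counts determine the size of every group `s = g`, `yh = v`. -/
lemma card_group_inter_eq_of_changes_eq {N : ℕ} (sh yh s s' : Fin N → Bool)
    (hchg : (chgA sh yh s, chgB sh yh s, chgC sh yh s, chgD sh yh s) =
            (chgA sh yh s', chgB sh yh s', chgC sh yh s', chgD sh yh s')) (g v : Bool) :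
    #{i | s i = g ∧ yh i = v} = #{i | s' i = g ∧ yh i = v} := by
  simp only [chgA, chgB, chgC, chgD, G0p, G1p, G0m, G1m, filter_filter, Prod.mk.injEq] at hchg
  have h := card_true_add_card_changes sh yh s v
  have h' := card_true_add_card_changes sh yh s' v
  have k := card_true_add_card_false yh s v
  have k' := card_true_add_card_false yh s' v
  cases g <;> cases v <;> omega

theorem rc_feasible_depends_only_on_change_counts (N : ℕ) (hN : 1 ≤ N)
    (sh yh : Fin N → Bool) (ε : ℝ) (hε : 0 ≤ ε) (s s' : Fin N → Bool)
    (hchg : (chgA sh yh s, chgB sh yh s, chgC sh yh s, chgD sh yh s) =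
            (chgA sh yh s', chgB sh yh s', chgC sh yh s', chgD sh yh s')) :
    RCFeasible yh ε s ↔ RCFeasible yh ε s' := by
  have hgv := card_group_inter_eq_of_changes_eq sh yh s s' hchg
  have hg (g : Bool) : #{i | s i = g} = #{i | s' i = g} := by
    rw [card_group_eq_add yh s g, card_group_eq_add yh s' g, hgv, hgv]
  simp only [RCFeasible, ← card_pos, hg, hgv]
end

section
/- For every reconstruction s* : Fin N → Bool with change counts χ(s*) = (a, b, c, d), the cost of s* is bounded below by the RC_E-objective at (a, b, c, d): cost(s*) ≥ T_{G₀⁺}(a) + T_{G₁⁺}(b) + T_{G₀⁻}(c) + T_{G₁⁻}(d). -/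
open Finset

/-- Cost of a reconstruction: total confidence of changed positions. -/
def cost {N : ℕ} (sh : Fin N → Bool) (p : Fin N → ℝ) (s : Fin N → Bool) : ℝ :=
  ∑ i ∈ univ.filter (fun i => s i ≠ sh i), p i

/-- T_G(j): the minimum total confidence of a size-j subset of G
(i.e., the sum of the j smallest confidence scores in G). -/
noncomputable def Tmin {N : ℕ} (G : Finset (Fin N)) (p : Fin N → ℝ) (j : ℕ) : ℝ :=
  sInf {x : ℝ | ∃ A : Finset (Fin N), A ⊆ G ∧ A.card = j ∧ x = ∑ i ∈ A, p i}

/-- The RC_E objective at a change-count tuple (a,b,c,d). -/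
noncomputable def objE {N : ℕ} (sh yh : Fin N → Bool) (p : Fin N → ℝ)
    (a b c d : ℕ) : ℝ :=
  Tmin (G0p sh yh) p a + Tmin (G1p sh yh) p b +
    Tmin (G0m sh yh) p c + Tmin (G1m sh yh) p d

theorem Tmin_le_sum {N : ℕ} {G A : Finset (Fin N)} {p : Fin N → ℝ} (hp : ∀ i, 0 ≤ p i)
    (hA : A ⊆ G) : Tmin G p A.card ≤ ∑ i ∈ A, p i := by
  refine csInf_le ⟨0, ?_⟩ ⟨A, hA, rfl, rfl⟩
  rintro x ⟨B, -, -, rfl⟩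
  exact sum_nonneg fun i _ => hp i

/-- The changed positions are partitioned by the four baseline groups. -/
theorem cost_eq_sum_groups {N : ℕ} (sh yh : Fin N → Bool) (p : Fin N → ℝ) (s : Fin N → Bool) :
    cost sh p s =
      ∑ i ∈ (G0p sh yh).filter (fun i => s i = true), p i +
        ∑ i ∈ (G1p sh yh).filter (fun i => s i = false), p i +
        ∑ i ∈ (G0m sh yh).filter (fun i => s i = true), p i +
        ∑ i ∈ (G1m sh yh).filter (fun i => s i = false), p i := by
  simp only [cost, G0p, G1p, G0m, G1m, filter_filter, sum_filter, ← sum_add_distrib]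
  refine sum_congr rfl fun i _ => ?_
  cases sh i <;> cases yh i <;> cases s i <;> simp

theorem cost_ge_objE (N : ℕ) (hN : 1 ≤ N) (sh yh : Fin N → Bool)
    (p : Fin N → ℝ) (hp : ∀ i, 0 ≤ p i) (s : Fin N → Bool) :
    cost sh p s ≥
      objE sh yh p (chgA sh yh s) (chgB sh yh s) (chgC sh yh s) (chgD sh yh s) := by
  rw [cost_eq_sum_groups sh yh]
  unfold objE chgA chgB chgC chgD
  gcongr <;> exact Tmin_le_sum hp (filter_subset _ _)
end

section
/- Parts (b) and (c) of the equivalence theorem: for every RC_E-feasible tuple (a, b, c, d), there exists an RC-feasible reconstruction s* : Fin N → Bool with change counts χ(s*) = (a, b, c, d) and cost(s*) equal to the RC_E-objective T_{G₀⁺}(a) + T_{G₁⁺}(b) + T_{G₀⁻}(c) + T_{G₁⁻}(d). -/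
open Finset

/-- The infimum defining `Tmin` is attained. -/
theorem exists_sum_eq_Tmin {N : ℕ} (G : Finset (Fin N)) (p : Fin N → ℝ) {j : ℕ}
    (hj : j ≤ G.card) : ∃ A ⊆ G, A.card = j ∧ ∑ i ∈ A, p i = Tmin G p j := by
  have hne : {x : ℝ | ∃ A : Finset (Fin N), A ⊆ G ∧ A.card = j ∧ x = ∑ i ∈ A, p i}.Nonempty := by
    obtain ⟨A, hA, hc⟩ := exists_subset_card_eq hj
    exact ⟨_, A, hA, hc, rfl⟩
  have hfin : {x : ℝ | ∃ A : Finset (Fin N), A ⊆ G ∧ A.card = j ∧ x = ∑ i ∈ A, p i}.Finite := by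
    refine (Set.finite_range fun A : Finset (Fin N) => ∑ i ∈ A, p i).subset ?_
    rintro x ⟨A, -, -, rfl⟩
    exact ⟨A, rfl⟩
  obtain ⟨A, hA, hc, h⟩ := hne.csInf_mem hfin
  exact ⟨A, hA, hc, h.symm⟩

section Counts

variable {N : ℕ} (sh yh s : Fin N → Bool)

theorem card_true_pos_add_chgB :
    (univ.filter fun i => s i = true ∧ yh i = true).card + chgB sh yh s =
      (G1p sh yh).card + chgA sh yh s := by
  simp only [chgA, chgB, G0p, G1p, filter_filter, card_filter, ← sum_add_distrib]
  refine sum_congr rfl fun i _ => ?_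
  cases s i <;> cases sh i <;> cases yh i <;> rfl

theorem card_false_pos_add_chgA :
    (univ.filter fun i => s i = false ∧ yh i = true).card + chgA sh yh s =
      (G0p sh yh).card + chgB sh yh s := by
  simp only [chgA, chgB, G0p, G1p, filter_filter, card_filter, ← sum_add_distrib]
  refine sum_congr rfl fun i _ => ?_
  cases s i <;> cases sh i <;> cases yh i <;> rfl

theorem card_true_add_chgB_add_chgD :
    (univ.filter fun i => s i = true).card + chgB sh yh s + chgD sh yh s =
      (G1p sh yh).card + (G1m sh yh).card + chgA sh yh s + chgC sh yh s := by
  simp only [chgA, chgB, chgC, chgD, G1p, G0p, G0m, G1m, filter_filter, card_filter,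
    ← sum_add_distrib]
  refine sum_congr rfl fun i _ => ?_
  cases s i <;> cases sh i <;> cases yh i <;> rfl

theorem card_false_add_chgA_add_chgC :
    (univ.filter fun i => s i = false).card + chgA sh yh s + chgC sh yh s =
      (G0p sh yh).card + (G0m sh yh).card + chgB sh yh s + chgD sh yh s := by
  simp only [chgA, chgB, chgC, chgD, G1p, G0p, G0m, G1m, filter_filter, card_filter,
    ← sum_add_distrib]
  refine sum_congr rfl fun i _ => ?_
  cases s i <;> cases sh i <;> cases yh i <;> rfl

theorem cost_eq_sum_changes (p : Fin N → ℝ) :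
    cost sh p s = ∑ i ∈ (G0p sh yh).filter (fun i => s i = true), p i +
      ∑ i ∈ (G1p sh yh).filter (fun i => s i = false), p i +
      ∑ i ∈ (G0m sh yh).filter (fun i => s i = true), p i +
      ∑ i ∈ (G1m sh yh).filter (fun i => s i = false), p i := by
  simp only [cost, G1p, G0p, G0m, G1m, filter_filter, sum_filter, ← sum_add_distrib]
  refine sum_congr rfl fun i _ => ?_
  cases s i <;> cases sh i <;> cases yh i <;> simp

/-- An RC_E-feasible tuple of change counts makes the reconstruction RC-feasible. -/
theorem rcFeasible_of_rceFeasible {ε : ℝ}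
    (h : RCEFeasible N (univ.filter (fun i => yh i = true)).card
      (G0p sh yh).card (G1p sh yh).card (G0m sh yh).card (G1m sh yh).card ε
      (chgA sh yh s) (chgB sh yh s) (chgC sh yh s) (chgD sh yh s)) :
    RCFeasible yh ε s := by
  obtain ⟨-, -, -, -, h0, h1, hε1, hε0⟩ := h
  have ht := card_true_add_chgB_add_chgD sh yh s
  have hf := card_false_add_chgA_add_chgC sh yh s
  have htp := card_true_pos_add_chgB sh yh s
  have hfp := card_false_pos_add_chgA sh yh s
  refine ⟨card_pos.mp (by omega), card_pos.mp (by omega), ?_⟩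
  rify at ht hf htp hfp
  rintro (_ | _)
  · convert hε0 using 4 <;> linarith
  · convert hε1 using 4 <;> linarith

end Counts

/-- Subsets of the four baseline groups can be prescribed as the sets of changed positions. -/
theorem exists_reconstruction {N : ℕ} (sh yh : Fin N → Bool) {A B C D : Finset (Fin N)}
    (hA : A ⊆ G0p sh yh) (hB : B ⊆ G1p sh yh) (hC : C ⊆ G0m sh yh) (hD : D ⊆ G1m sh yh) :
    ∃ s : Fin N → Bool, (G0p sh yh).filter (fun i => s i = true) = A ∧
      (G1p sh yh).filter (fun i => s i = false) = B ∧
      (G0m sh yh).filter (fun i => s i = true) = C ∧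
      (G1m sh yh).filter (fun i => s i = false) = D := by
  simp only [subset_iff, G0p, G1p, G0m, G1m, mem_filter, mem_univ, true_and] at hA hB hC hD
  refine ⟨fun i => decide (i ∈ A ∨ i ∈ C ∨ (sh i = true ∧ i ∉ B ∧ i ∉ D)), ?_, ?_, ?_, ?_⟩ <;>
  · ext i
    have := @hA i
    have := @hB i
    have := @hC i
    have := @hD i
    simp only [G0p, G1p, G0m, G1m, mem_filter, mem_univ, true_and, decide_eq_true_eq,
      decide_eq_false_iff_not]
    grind

theorem rce_feasible_implies_exists_rc_feasible (N : ℕ) (hN : 1 ≤ N)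
    (sh yh : Fin N → Bool) (p : Fin N → ℝ) (hp : ∀ i, 0 ≤ p i)
    (ε : ℝ) (hε : 0 ≤ ε) (a b c d : ℕ)
    (hRCE : RCEFeasible N (univ.filter (fun i => yh i = true)).card
      (G0p sh yh).card (G1p sh yh).card (G0m sh yh).card (G1m sh yh).card ε
      a b c d) :
    ∃ s : Fin N → Bool, RCFeasible yh ε s ∧
      chgA sh yh s = a ∧ chgB sh yh s = b ∧ chgC sh yh s = c ∧ chgD sh yh s = d ∧
      cost sh p s = objE sh yh p a b c d := by
  obtain ⟨A, hA, rfl, hAp⟩ := exists_sum_eq_Tmin _ p hRCE.1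
  obtain ⟨B, hB, rfl, hBp⟩ := exists_sum_eq_Tmin _ p hRCE.2.1
  obtain ⟨C, hC, rfl, hCp⟩ := exists_sum_eq_Tmin _ p hRCE.2.2.1
  obtain ⟨D, hD, rfl, hDp⟩ := exists_sum_eq_Tmin _ p hRCE.2.2.2.1
  obtain ⟨s, rfl, rfl, rfl, rfl⟩ := exists_reconstruction sh yh hA hB hC hD
  refine ⟨s, rcFeasible_of_rceFeasible sh yh s hRCE, rfl, rfl, rfl, rfl, ?_⟩
  rw [cost_eq_sum_changes sh yh s p, objE, ← hAp, ← hBp, ← hCp, ← hDp]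
end

section
/- Exchange lemma: let s* : Fin N → Bool be RC-feasible and let i ≠ j be indices with ŝ i = ŝ j and ŷ i = ŷ j, such that s* i ≠ ŝ i and s* j = ŝ j. Define s*' by s*' i = ŝ i, s*' j = ¬ ŝ j, and s*' l = s* l for all l ∉ {i, j}. Then s*' is RC-feasible and cost(s*') = cost(s*) − p i + p j; in particular, if p j < p i then cost(s*') < cost(s*). -/
open Finset

/-- The reconstruction obtained by exchanging positions `i` and `j` is `s` composed with a swap. -/
theorem exchange_eq_comp_swap {N : ℕ} {sh s : Fin N → Bool} {i j : Fin N}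
    (hsh : sh i = sh j) (hsi : s i ≠ sh i) (hsj : s j = sh j) :
    (fun l => if l = i then sh i else if l = j then !(sh j) else s l) =
      s ∘ Equiv.swap i j := by
  funext l
  have hsi' : s i = !(sh j) := by rw [← hsh]; exact Bool.eq_not_of_ne hsi
  by_cases hli : l = i
  · simp [hli, hsj, hsh]
  · by_cases hlj : l = j
    · subst hlj
      simp [hli, hsi']
    · simp [hli, hlj, Equiv.swap_apply_of_ne_of_ne hli hlj]

/-- RC-feasibility is invariant under permutations that preserve the predictions. -/
theorem RCFeasible.comp_perm {N : ℕ} {yh s : Fin N → Bool} {ε : ℝ}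
    (h : RCFeasible yh ε s) (σ : Equiv.Perm (Fin N)) (hσ : ∀ l, yh (σ l) = yh l) :
    RCFeasible yh ε (s ∘ σ) := by
  obtain ⟨⟨a, ha⟩, ⟨b, hb⟩, hpar⟩ := h
  refine ⟨⟨σ.symm a, by simpa using ha⟩, ⟨σ.symm b, by simpa using hb⟩, fun g => ?_⟩
  have hgroup : (univ.filter fun l => (s ∘ σ) l = g).card =
      (univ.filter fun l => s l = g).card :=
    Finset.card_equiv σ (by simp)
  have hpos : (univ.filter fun l => (s ∘ σ) l = g ∧ yh l = true).card =
      (univ.filter fun l => s l = g ∧ yh l = true).card :=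
    Finset.card_equiv σ (by simp [hσ])
  rw [hgroup, hpos]
  exact hpar g

/-- Exchanging a changed position `i` with an unchanged position `j` trades `p i` for `p j`. -/
theorem cost_exchange {N : ℕ} {sh s : Fin N → Bool} (p : Fin N → ℝ) {i j : Fin N}
    (hij : i ≠ j) (hsi : s i ≠ sh i) (hsj : s j = sh j) :
    cost sh p (fun l => if l = i then sh i else if l = j then !(sh j) else s l) =
      cost sh p s - p i + p j := by
  have hchanged : (univ.filter fun l =>
      (if l = i then sh i else if l = j then !(sh j) else s l) ≠ sh l) =
      insert j ((univ.filter fun l => s l ≠ sh l).erase i) := by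
    ext l
    by_cases hli : l = i
    · simp [hli, hij]
    · by_cases hlj : l = j
      · simp [hlj, hij.symm]
      · simp [hli, hlj]
  unfold cost
  rw [hchanged, Finset.sum_insert (by simp [hsj]),
    Finset.sum_erase_eq_sub (by simpa using hsi), add_comm]

theorem exchange_lemma (N : ℕ) (hN : 1 ≤ N)
    (sh yh : Fin N → Bool) (p : Fin N → ℝ) (hp : ∀ i, 0 ≤ p i)
    (ε : ℝ) (hε : 0 ≤ ε) (s : Fin N → Bool) (hfeas : RCFeasible yh ε s)
    (i j : Fin N) (hij : i ≠ j) (hsh : sh i = sh j) (hyh : yh i = yh j)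
    (hsi : s i ≠ sh i) (hsj : s j = sh j) :
    RCFeasible yh ε (fun l => if l = i then sh i else if l = j then !(sh j) else s l) ∧
    cost sh p (fun l => if l = i then sh i else if l = j then !(sh j) else s l) =
      cost sh p s - p i + p j ∧
    (p j < p i →
      cost sh p (fun l => if l = i then sh i else if l = j then !(sh j) else s l) <
        cost sh p s) := by
  have hcost := cost_exchange p hij hsi hsj
  refine ⟨?_, hcost, fun hlt => by linarith⟩
  rw [exchange_eq_comp_swap hsh hsi hsj]
  refine hfeas.comp_perm _ fun l => ?_
  rw [Equiv.apply_swap_eq_self hyh]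
end
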